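/- Let T_1 and T_2 be rooted trees of orders n_1 and n_2. Then: (i) ρ(T_1 ⊠ T_2) ≥ n_2·ρ(T_1); (ii) ρ(T_1 ⊠ T_2) ≥ ρ(T_2) + (ρ(T_1) − 1)·H(T_2); (iii) ρ(T_1 ⊠ T_2) < n_2·ρ(T_1) + ρ(T_2). Here ρ denotes the Perron value and H the Perron entropy. -/

import Mathlib

open Matrix SimpleGraph
open scoped Kronecker

attribute [local instance 10] Classical.propDecidable

/-- A rooted tree: a tree (connected acyclic simple graph) with a distinguished root. -/
structure RTree (V : Type) where
  G : SimpleGraph V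
  isTree : G.IsTree
  root : V

namespace RTree

variable {V : Type}

/-- `T.pord j i` means `j ⪯ i`: the (unique) path joining `j` to the root contains `i`. -/
def pord (T : RTree V) (j i : V) : Prop :=
  T.G.dist j T.root = T.G.dist j i + T.G.dist i T.root

/-- The path matrix `N`: the `(i,j)` entry is `1` if `j ⪯ i` and `0` otherwise. -/
noncomputable def pathMatrix (T : RTree V) : Matrix V V ℝ :=
  Matrix.of fun i j => if T.pord j i then 1 else 0

/-- The bottleneck matrix `M = NᵀN`: the `(i,j)` entry is the number of vertices lying
simultaneously on the path from `i` to the root and on the path from `j` to the root. -/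
noncomputable def bottleneck (T : RTree V) : Matrix V V ℝ :=
  Matrix.of fun i j => (Nat.card {v : V | T.pord i v ∧ T.pord j v} : ℝ)

/-- The neckbottle matrix `Q = N Nᵀ`. -/
noncomputable def neckbottle [Fintype V] (T : RTree V) : Matrix V V ℝ :=
  T.pathMatrix * T.pathMatrixᵀ

/-- The Perron value of a rooted tree: the largest eigenvalue of its bottleneck matrix. -/
noncomputable def perron [Fintype V] (T : RTree V) : ℝ :=
  sSup {t : ℝ | ∃ w : V → ℝ, w ≠ 0 ∧ T.bottleneck *ᵥ w = t • w}

/-- The degree of a vertex. -/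
noncomputable def degree (T : RTree V) (v : V) : ℕ :=
  Nat.card {u : V | T.G.Adj v u}

/-- The moment `μ(T) = ∑ᵥ dist(v, root) · deg(v)`. -/
noncomputable def moment [Fintype V] (T : RTree V) : ℕ :=
  ∑ v : V, T.G.dist v T.root * T.degree v

/-- The root-transmission `t(T) = ∑ᵥ dist(v, root)`. -/
noncomputable def transmission [Fintype V] (T : RTree V) : ℕ :=
  ∑ v : V, T.G.dist v T.root

end RTree

section Helpers

lemma rayleigh_top_aux {V : Type} [Fintype V] [Nonempty V] (A : Matrix V V ℝ) (hA : A.IsSymm) :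
    ∃ c : ℝ, (∃ w : V → ℝ, w ≠ 0 ∧ A *ᵥ w = c • w) ∧
      ∀ x : V → ℝ, x ⬝ᵥ (A *ᵥ x) ≤ c * (x ⬝ᵥ x) := by
  have hH : A.IsHermitian := by
    ext i j
    simpa using hA.apply i j
  have hS := Matrix.isSymmetric_toEuclideanLin_iff.mpr hH
  have hev := hS.hasEigenvalue_iSup_of_finiteDimensional
  refine ⟨⨆ x : { x : EuclideanSpace ℝ V // x ≠ 0 },
    RCLike.re (inner ℝ (A.toEuclideanLin x) (x : EuclideanSpace ℝ V)) /
          ‖(x : EuclideanSpace ℝ V)‖ ^ 2, ?_, ?_⟩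
  · obtain ⟨v, hv⟩ := hev.exists_hasEigenvector
    refine ⟨v.ofLp, fun h => hv.2 ?_, ?_⟩
    · ext i
      exact congrFun h i
    · have h1 := congrArg WithLp.ofLp hv.apply_eq_smul
      simpa [Matrix.toLpLin_apply] using h1
  · intro x
    by_cases hx : x = 0
    · simp [hx]
    have hx' : WithLp.toLp 2 x ≠ 0 := by
      intro h
      exact hx (congrArg WithLp.ofLp h)
    have hb : BddAbove (Set.range fun x : { x : EuclideanSpace ℝ V // x ≠ 0 } =>
        RCLike.re (inner ℝ (A.toEuclideanLin x) (x : EuclideanSpace ℝ V)) /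
          ‖(x : EuclideanSpace ℝ V)‖ ^ 2) := by
      refine ⟨‖A.toEuclideanLin.toContinuousLinearMap‖, ?_⟩
      rintro _ ⟨y, rfl⟩
      have hy : 0 < ‖(y : EuclideanSpace ℝ V)‖ := norm_pos_iff.mpr y.2
      simp only
      rw [div_le_iff₀ (by positivity)]
      have h1 := real_inner_le_norm (A.toEuclideanLin y) (y : EuclideanSpace ℝ V)
      have h2 := A.toEuclideanLin.toContinuousLinearMap.le_opNorm y
      simp only [LinearMap.coe_toContinuousLinearMap'] at h2
      simp only [RCLike.re_to_real]
      nlinarith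
    have := le_ciSup hb ⟨WithLp.toLp 2 x, hx'⟩
    simp only at this
    have hp : 0 < ‖WithLp.toLp 2 x‖ := norm_pos_iff.mpr hx'
    rw [div_le_iff₀ (by positivity)] at this
    have e1 : RCLike.re (inner ℝ (A.toEuclideanLin (WithLp.toLp 2 x)) (WithLp.toLp 2 x))
        = x ⬝ᵥ A *ᵥ x := by
      simp [Matrix.toLpLin_apply, EuclideanSpace.inner_eq_star_dotProduct]
    have e2 : ‖WithLp.toLp 2 x‖ ^ 2 = x ⬝ᵥ x := by
      rw [← real_inner_self_eq_norm_sq, EuclideanSpace.inner_eq_star_dotProduct]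
      simp
    rw [e1, e2] at this
    exact this

namespace RTree

variable {V : Type}

/-- The quadratic form of the bottleneck matrix, as a sum of squares. -/
noncomputable def qf [Fintype V] (T : RTree V) (x : V → ℝ) : ℝ :=
  ∑ v, (∑ i, if T.pord i v then x i else 0) ^ 2

lemma bottleneck_eq [Fintype V] (T : RTree V) (i j : V) :
    T.bottleneck i j = ∑ v, (if T.pord i v then 1 else 0) * (if T.pord j v then 1 else 0) := by
  simp only [bottleneck, Matrix.of_apply, Nat.card_eq_fintype_card, Set.coe_ofPred,
    Fintype.card_subtype, Finset.card_filter, Nat.cast_sum]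
  refine Finset.sum_congr rfl fun v _ => ?_
  by_cases h1 : T.pord i v <;> by_cases h2 : T.pord j v <;> simp [h1, h2]

lemma bottleneck_symm (T : RTree V) : T.bottleneck.IsSymm := by
  ext i j
  simp only [bottleneck, Matrix.transpose_apply, Matrix.of_apply, and_comm]

lemma qf_eq [Fintype V] (T : RTree V) (x : V → ℝ) : x ⬝ᵥ (T.bottleneck *ᵥ x) = T.qf x := by
  have hM : T.bottleneck = T.pathMatrixᵀ * T.pathMatrix := by
    ext i j
    rw [bottleneck_eq]
    simp [Matrix.mul_apply, pathMatrix]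
  rw [hM, ← Matrix.mulVec_mulVec, Matrix.dotProduct_mulVec, Matrix.vecMul_transpose]
  simp [qf, dotProduct, mulVec, pathMatrix, sq]

lemma perron_spec [Fintype V] (T : RTree V) :
    (∃ w : V → ℝ, w ≠ 0 ∧ T.bottleneck *ᵥ w = T.perron • w) ∧
      ∀ x : V → ℝ, T.qf x ≤ T.perron * ∑ i, x i ^ 2 := by
  have : Nonempty V := ⟨T.root⟩
  obtain ⟨c, hc, hle⟩ := rayleigh_top_aux T.bottleneck T.bottleneck_symm
  have hg : IsGreatest {t : ℝ | ∃ w : V → ℝ, w ≠ 0 ∧ T.bottleneck *ᵥ w = t • w} c := by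
    refine ⟨hc, ?_⟩
    rintro t ⟨w, hw, h⟩
    have h1 := hle w
    rw [h, dotProduct_smul, smul_eq_mul] at h1
    refine le_of_mul_le_mul_right h1 ?_
    have := dotProduct_star_self_pos_iff.mpr hw
    simpa using this
  have hp : T.perron = c := hg.csSup_eq
  rw [hp]
  refine ⟨hc, fun x => ?_⟩
  have := hle x
  rw [qf_eq] at this
  simpa [dotProduct, sq] using this

lemma qf_eigen [Fintype V] (T : RTree V) {w : V → ℝ} {c : ℝ} (h : T.bottleneck *ᵥ w = c • w) :
    T.qf w = c * ∑ i, w i ^ 2 := by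
  rw [← qf_eq, h, dotProduct_smul, smul_eq_mul]
  simp [dotProduct, sq]

lemma sum_sq_pos' [Fintype V] {w : V → ℝ} (hw : w ≠ 0) : 0 < ∑ i, w i ^ 2 := by
  have := dotProduct_star_self_pos_iff.mpr hw
  simpa [dotProduct, sq] using this

lemma pord_refl (T : RTree V) (i : V) : T.pord i i := by simp [pord]

lemma pord_root (T : RTree V) (i : V) : T.pord i T.root := by simp [pord]

lemma sq_sum_le_qf [Fintype V] (T : RTree V) (x : V → ℝ) : (∑ i, x i) ^ 2 ≤ T.qf x := by
  have := Finset.single_le_sum (s := Finset.univ)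
    (f := fun v => (∑ i, if T.pord i v then x i else 0) ^ 2)
    (fun v _ => sq_nonneg _) (Finset.mem_univ T.root)
  simpa [qf, pord_root] using this

lemma one_le_perron [Fintype V] (T : RTree V) : 1 ≤ T.perron := by
  have h := (T.perron_spec.2 (Pi.single T.root 1))
  have h2 := T.sq_sum_le_qf (Pi.single T.root 1)
  have h3 : ∑ i, (Pi.single T.root (1:ℝ) : V → ℝ) i ^ 2 = 1 := by
    rw [Finset.sum_eq_single T.root] <;> simp +contextual
  rw [h3] at h
  simp at h2
  linarith

end RTree

section Product

variable {V₁ V₂ : Type} (T₁ : RTree V₁) (T₂ : RTree V₂) (S : RTree (V₁ × V₂))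

/-- The distance in the rooted product. -/
noncomputable def pdist (p q : V₁ × V₂) : ℕ :=
  if p.1 = q.1 then T₂.G.dist p.2 q.2
  else T₂.G.dist p.2 T₂.root + T₁.G.dist p.1 q.1 + T₂.G.dist T₂.root q.2

lemma pdist_step
    (hadj : ∀ (i j : V₁) (a b : V₂), S.G.Adj (i, a) (j, b) ↔
      (i = j ∧ T₂.G.Adj a b) ∨ (T₁.G.Adj i j ∧ a = T₂.root ∧ b = T₂.root))
    (p p' q : V₁ × V₂) (h : S.G.Adj p p') :
    pdist T₁ T₂ p q ≤ pdist T₁ T₂ p' q + 1 := by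
  obtain ⟨i, a⟩ := p
  obtain ⟨i', a'⟩ := p'
  obtain ⟨j, b⟩ := q
  have t1 := T₁.isTree.connected.dist_triangle (u := i) (v := i') (w := j)
  have t2 := T₂.isTree.connected.dist_triangle (u := a) (v := a') (w := b)
  have t3 := T₂.isTree.connected.dist_triangle (u := a) (v := a') (w := T₂.root)
  rcases (hadj i i' a a').1 h with ⟨rfl, h2⟩ | ⟨h1, rfl, rfl⟩
  · have := SimpleGraph.dist_eq_one_iff_adj.2 h2
    simp only [pdist]
    split_ifs <;> omega
  · have := SimpleGraph.dist_eq_one_iff_adj.2 h1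
    have hne := h1.ne
    simp only [pdist, SimpleGraph.dist_self]
    split_ifs with h3 h4 h4
    · omega
    · omega
    · subst h4
      omega
    · omega

lemma pdist_eq
    (hadj : ∀ (i j : V₁) (a b : V₂), S.G.Adj (i, a) (j, b) ↔
      (i = j ∧ T₂.G.Adj a b) ∨ (T₁.G.Adj i j ∧ a = T₂.root ∧ b = T₂.root))
    (p q : V₁ × V₂) : S.G.dist p q = pdist T₁ T₂ p q := by
  apply le_antisymm
  · have e2 : ∀ (i : V₁) (a b : V₂), S.G.dist (i, a) (i, b) ≤ T₂.G.dist a b := by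
      intro i a b
      obtain ⟨w, hw⟩ := T₂.isTree.connected.exists_walk_length_eq_dist a b
      let f : T₂.G →g S.G := ⟨fun a => (i, a), fun {a b} h => (hadj i i a b).2 (Or.inl ⟨rfl, h⟩)⟩
      have := SimpleGraph.dist_le (w.map f)
      rw [SimpleGraph.Walk.length_map, hw] at this
      exact this
    have e1 : ∀ (i j : V₁), S.G.dist (i, T₂.root) (j, T₂.root) ≤ T₁.G.dist i j := by
      intro i j
      obtain ⟨w, hw⟩ := T₁.isTree.connected.exists_walk_length_eq_dist i j
      let f : T₁.G →g S.G := ⟨fun i => (i, T₂.root),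
        fun {i j} h => (hadj i j _ _).2 (Or.inr ⟨h, rfl, rfl⟩)⟩
      have := SimpleGraph.dist_le (w.map f)
      rw [SimpleGraph.Walk.length_map, hw] at this
      exact this
    obtain ⟨i, a⟩ := p
    obtain ⟨j, b⟩ := q
    simp only [pdist]
    split_ifs with h
    · subst h
      exact e2 _ _ _
    · have t1 := S.isTree.connected.dist_triangle (u := (i, a)) (v := (i, T₂.root)) (w := (j, b))
      have t2 := S.isTree.connected.dist_triangle
        (u := (i, T₂.root)) (v := (j, T₂.root)) (w := (j, b))
      have := e2 i a T₂.root
      have := e2 j T₂.root b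
      have := e1 i j
      omega
  · obtain ⟨w, hw⟩ := S.isTree.connected.exists_walk_length_eq_dist p q
    rw [← hw]
    clear hw
    induction w with
    | nil => simp [pdist]
    | cons h w ih =>
      have := pdist_step T₁ T₂ S hadj _ _ _ h |>.trans (Nat.add_le_add_right ih 1)
      simpa using this

lemma pord_prod
    (hadj : ∀ (i j : V₁) (a b : V₂), S.G.Adj (i, a) (j, b) ↔
      (i = j ∧ T₂.G.Adj a b) ∨ (T₁.G.Adj i j ∧ a = T₂.root ∧ b = T₂.root))
    (hroot : S.root = (T₁.root, T₂.root)) (i j : V₁) (a b : V₂) :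
    S.pord (i, a) (j, b) ↔ (i = j ∧ T₂.pord a b) ∨ (i ≠ j ∧ T₁.pord i j ∧ b = T₂.root) := by
  have hr : ∀ i a, S.G.dist (i, a) S.root = T₂.G.dist a T₂.root + T₁.G.dist i T₁.root := by
    intro i a
    rw [pdist_eq T₁ T₂ S hadj, hroot]
    simp only [pdist]
    split_ifs with h
    · simp [h]
    · simp
  simp only [RTree.pord, hr]
  rw [pdist_eq T₁ T₂ S hadj]
  simp only [pdist]
  have hb : T₂.G.dist b T₂.root = 0 ↔ b = T₂.root := T₂.isTree.connected.dist_eq_zero_iff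
  have hs : T₂.G.dist T₂.root b = T₂.G.dist b T₂.root := SimpleGraph.dist_comm
  have t := T₁.isTree.connected.dist_triangle (u := i) (v := j) (w := T₁.root)
  split_ifs with h
  · subst h
    simp
    omega
  · simp only [h, false_and, false_or, ne_eq, not_false_eq_true, true_and, ← hb]
    omega

lemma qf_prod [Fintype V₁] [Fintype V₂]
    (hadj : ∀ (i j : V₁) (a b : V₂), S.G.Adj (i, a) (j, b) ↔
      (i = j ∧ T₂.G.Adj a b) ∨ (T₁.G.Adj i j ∧ a = T₂.root ∧ b = T₂.root))
    (hroot : S.root = (T₁.root, T₂.root))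
    (u : V₁ × V₂ → ℝ) :
    S.qf u = ∑ j, T₂.qf (fun a => u (j, a)) - ∑ j, (∑ a, u (j, a)) ^ 2
      + T₁.qf (fun j => ∑ a, u (j, a)) := by
  have key : ∀ j, ∑ b, (∑ p : V₁ × V₂, if S.pord p (j, b) then u p else 0) ^ 2
      = T₂.qf (fun a => u (j, a)) - (∑ a, u (j, a)) ^ 2
        + (∑ i, if T₁.pord i j then ∑ a, u (i, a) else 0) ^ 2 := by
    intro j
    unfold RTree.qf
    rw [← Finset.add_sum_erase _ _ (Finset.mem_univ T₂.root),
      ← Finset.add_sum_erase _ (fun v => (∑ i, if T₂.pord i v then u (j, i) else 0) ^ 2)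
        (Finset.mem_univ T₂.root)]
    have h1 : ∑ p : V₁ × V₂, (if S.pord p (j, T₂.root) then u p else 0)
        = ∑ i, if T₁.pord i j then ∑ a, u (i, a) else 0 := by
      rw [Fintype.sum_prod_type]
      refine Finset.sum_congr rfl fun i _ => ?_
      simp only [pord_prod T₁ T₂ S hadj hroot, RTree.pord_root]
      by_cases hij : i = j
      · subst hij
        simp [RTree.pord_refl]
      · by_cases hp : T₁.pord i j <;> simp [hij, hp]
    have h2 : ∀ b ∈ Finset.univ.erase T₂.root,
        (∑ p : V₁ × V₂, (if S.pord p (j, b) then u p else 0)) ^ 2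
        = (∑ a, if T₂.pord a b then u (j, a) else 0) ^ 2 := by
      intro b hb
      have hb' : b ≠ T₂.root := Finset.ne_of_mem_erase hb
      rw [Fintype.sum_prod_type]
      simp only [pord_prod T₁ T₂ S hadj hroot, hb', and_false, or_false]
      rw [Finset.sum_eq_single j]
      · simp
      · intro i _ hij
        simp [hij]
      · simp
    rw [h1, Finset.sum_congr rfl h2]
    simp only [RTree.pord_root, if_true]
    ring
  have : S.qf u = ∑ j, ∑ b, (∑ p : V₁ × V₂, if S.pord p (j, b) then u p else 0) ^ 2 := by
    unfold RTree.qf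
    rw [Fintype.sum_prod_type]
  rw [this, Finset.sum_congr rfl fun j _ => key j, Finset.sum_add_distrib,
    Finset.sum_sub_distrib]
  rfl

end Product

end Helpers

/-- Let `S = T₁ ⊠ T₂` be the rooted product (vertex set `V₁ × V₂`,
with a copy of `T₂` for every vertex of `T₁`, roots of copies joined according to the
edges of `T₁`, rooted at the root of the copy at the root of `T₁`). Then
(i) `ρ(S) ≥ n₂ ρ(T₁)`;
(ii) `ρ(S) ≥ ρ(T₂) + (ρ(T₁) − 1) H(T₂)`, where `H(T₂) = (eᵀw)²/‖w‖²` for any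
eigenvector `w` of the bottleneck matrix of `T₂` for the Perron value `ρ(T₂)`;
(iii) `ρ(S) < n₂ ρ(T₁) + ρ(T₂)`. -/
theorem perron_rooted_product {V₁ V₂ : Type} [Fintype V₁] [Fintype V₂]
    (T₁ : RTree V₁) (T₂ : RTree V₂)
    (n₂ : ℕ) (hn₂ : n₂ = Fintype.card V₂)
    (S : RTree (V₁ × V₂))
    (hroot : S.root = (T₁.root, T₂.root))
    (hadj : ∀ (i j : V₁) (a b : V₂), S.G.Adj (i, a) (j, b) ↔
      (i = j ∧ T₂.G.Adj a b) ∨ (T₁.G.Adj i j ∧ a = T₂.root ∧ b = T₂.root)) :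
    (n₂ : ℝ) * T₁.perron ≤ S.perron ∧
      (∀ w : V₂ → ℝ, w ≠ 0 → T₂.bottleneck *ᵥ w = T₂.perron • w →
        T₂.perron + (T₁.perron - 1) * ((∑ a, w a) ^ 2 / (∑ a, (w a) ^ 2)) ≤ S.perron) ∧
      S.perron < (n₂ : ℝ) * T₁.perron + T₂.perron := by
  subst hn₂
  have hq := qf_prod T₁ T₂ S hadj hroot
  obtain ⟨⟨x, hx0, hx⟩, hmax1⟩ := T₁.perron_spec
  obtain ⟨-, hmax2⟩ := T₂.perron_spec
  obtain ⟨⟨u, hu0, hu⟩, hmaxS⟩ := S.perron_spec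
  have hxpos := RTree.sum_sq_pos' hx0
  have hxq := T₁.qf_eigen hx
  have h1 := T₁.one_le_perron
  have hcard : (0:ℝ) < Fintype.card V₂ := by
    have : Nonempty V₂ := ⟨T₂.root⟩
    exact_mod_cast Fintype.card_pos
  -- value of the form on tensor vectors
  have hscale1 : ∀ (c : ℝ) (y : V₁ → ℝ), T₁.qf (fun j => y j * c) = T₁.qf y * c ^ 2 := by
    intro c y
    simp only [RTree.qf, Finset.sum_mul, ← mul_pow, ite_mul, zero_mul]
  have hscale2 : ∀ (c : ℝ) (y : V₂ → ℝ), T₂.qf (fun j => c * y j) = c ^ 2 * T₂.qf y := by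
    intro c y
    simp only [RTree.qf, Finset.mul_sum, ← mul_pow, mul_ite, mul_zero]
  have htens : ∀ w : V₂ → ℝ, (∑ i, x i ^ 2) * (T₂.qf w - (∑ a, w a) ^ 2
      + T₁.perron * (∑ a, w a) ^ 2) ≤ S.perron * ((∑ i, x i ^ 2) * ∑ a, w a ^ 2) := by
    intro w
    have h := hmaxS (fun p => x p.1 * w p.2)
    rw [hq] at h
    simp only [← Finset.mul_sum, hscale2, hscale1, hxq, mul_pow, ← Finset.sum_mul,
      Fintype.sum_prod_type] at h
    linarith
  have htens' : ∀ w : V₂ → ℝ, T₂.qf w - (∑ a, w a) ^ 2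
      + T₁.perron * (∑ a, w a) ^ 2 ≤ S.perron * ∑ a, w a ^ 2 := by
    intro w
    refine le_of_mul_le_mul_left ?_ hxpos
    linarith [htens w]
  refine ⟨?_, ?_, ?_⟩
  · have h := htens' (fun _ => 1)
    have h2 := T₂.sq_sum_le_qf (fun _ => 1)
    simp at h h2
    refine le_of_mul_le_mul_right ?_ hcard
    nlinarith
  · intro w hw0 hw
    have h := htens' w
    have hwp := RTree.sum_sq_pos' hw0
    rw [T₂.qf_eigen hw] at h
    refine le_of_mul_le_mul_right ?_ hwp
    rw [add_mul, mul_assoc, div_mul_cancel₀ _ hwp.ne']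
    linarith
  · have hup := RTree.sum_sq_pos' hu0
    have huq := S.qf_eigen hu
    rw [hq] at huq
    refine lt_of_mul_lt_mul_right ?_ hup.le
    rw [← huq]
    have ha : ∑ j, T₂.qf (fun a => u (j, a)) ≤ T₂.perron * ∑ p, u p ^ 2 := by
      rw [Fintype.sum_prod_type, Finset.mul_sum]
      exact Finset.sum_le_sum fun j _ => hmax2 _
    have hb := hmax1 (fun j => ∑ a, u (j, a))
    have hc : ∑ j, (∑ a, u (j, a)) ^ 2 ≤ Fintype.card V₂ * ∑ p, u p ^ 2 := by
      rw [Fintype.sum_prod_type, Finset.mul_sum]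
      refine Finset.sum_le_sum fun j _ => ?_
      have := sq_sum_le_card_mul_sum_sq (s := Finset.univ) (f := fun a => u (j, a))
      simpa using this
    have hd := mul_le_mul_of_nonneg_left hc (sub_nonneg.2 h1)
    have he := mul_pos hcard hup
    nlinarith
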